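/- For every k ≥ 1, d(V^k W^k, W^k V^k) = 4k², where V = σ_1² and W = σ_2σ_1²σ_2 are words in the generators of B_3; here V^k W^k and W^k V^k represent the same (non-identity) element of B_3, and the minimal number of applications of the relation σ_1σ_2σ_1 = σ_2σ_1σ_2 needed to transform one into the other is exactly 4k². -/

import Mathlib

namespace Braid

/-- A letter `σ_i^{±1}`: generator index `i` and sign (`true` = `σ_i`, `false` = `σ_i⁻¹`). -/
abbrev BraidLetter : Type := ℕ × Bool

/-- A word in the braid generators: a finite sequence of letters `σ_i^{±1}`. -/
abbrev BraidWord : Type := List BraidLetter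

/-- `w` is a word in the generators `σ_1, …, σ_{n-1}` of `B_n`. -/
def IsWord (n : ℕ) (w : BraidWord) : Prop := ∀ l ∈ w, 1 ≤ l.1 ∧ l.1 < n

/-- The relators of the braid group `B_n`, inside the free group on generators
indexed by `ℕ` (only the generators `σ_1, …, σ_{n-1}` are involved in relations,
so that on words in these generators the presented group is exactly `B_n`). -/
def braidRels (n : ℕ) : Set (FreeGroup ℕ) :=
  {r | ∃ i : ℕ, 1 ≤ i ∧ i + 2 ≤ n ∧
      r = FreeGroup.of i * FreeGroup.of (i+1) * FreeGroup.of i *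
          (FreeGroup.of (i+1) * FreeGroup.of i * FreeGroup.of (i+1))⁻¹} ∪
  {r | ∃ i j : ℕ, 1 ≤ i ∧ 1 ≤ j ∧ i < n ∧ j < n ∧ i + 2 ≤ j ∧
      r = FreeGroup.of i * FreeGroup.of j * (FreeGroup.of j * FreeGroup.of i)⁻¹}

/-- The braid group `B_n`, presented by the generators `σ_i` and the braid relations. -/
abbrev BraidGroup (n : ℕ) := PresentedGroup (braidRels n)

/-- The element of `B_n` represented by a single letter `σ_i^{±1}`. -/
def evalLetter (n : ℕ) (l : BraidLetter) : BraidGroup n :=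
  if l.2 then PresentedGroup.of l.1 else (PresentedGroup.of l.1)⁻¹

/-- The element of `B_n` represented by a word. -/
def eval (n : ℕ) (w : BraidWord) : BraidGroup n := (w.map (evalLetter n)).prod

/-- Type (1) elementary modification: replacing a subword `σ_i σ_{i+1} σ_i` by
`σ_{i+1} σ_i σ_{i+1}` or vice versa, `1 ≤ i ≤ n - 2`. -/
inductive Move1 (n : ℕ) : BraidWord → BraidWord → Prop
  | fwd (u v : BraidWord) (i : ℕ) (h1 : 1 ≤ i) (h2 : i + 2 ≤ n) :
      Move1 n (u ++ [(i, true), (i+1, true), (i, true)] ++ v)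
              (u ++ [(i+1, true), (i, true), (i+1, true)] ++ v)
  | bwd (u v : BraidWord) (i : ℕ) (h1 : 1 ≤ i) (h2 : i + 2 ≤ n) :
      Move1 n (u ++ [(i+1, true), (i, true), (i+1, true)] ++ v)
              (u ++ [(i, true), (i+1, true), (i, true)] ++ v)

/-- Type (2) elementary modification: replacing a subword `σ_i σ_j` by `σ_j σ_i`
for `|i - j| ≥ 2` (in either direction, as `i` and `j` are symmetric). -/
inductive Move2 (n : ℕ) : BraidWord → BraidWord → Prop
  | swap (u v : BraidWord) (i j : ℕ) (h1 : 1 ≤ i) (h2 : 1 ≤ j)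
      (h3 : i < n) (h4 : j < n) (h5 : i + 2 ≤ j ∨ j + 2 ≤ i) :
      Move2 n (u ++ [(i, true), (j, true)] ++ v)
              (u ++ [(j, true), (i, true)] ++ v)

/-- Type (3) elementary modification: deleting or inserting a subword
`σ_i σ_i⁻¹` or `σ_i⁻¹ σ_i`. -/
inductive Move3 (n : ℕ) : BraidWord → BraidWord → Prop
  | del (u v : BraidWord) (i : ℕ) (b : Bool) (h1 : 1 ≤ i) (h2 : i < n) :
      Move3 n (u ++ [(i, b), (i, !b)] ++ v) (u ++ v)
  | ins (u v : BraidWord) (i : ℕ) (b : Bool) (h1 : 1 ≤ i) (h2 : i < n) :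
      Move3 n (u ++ v) (u ++ [(i, b), (i, !b)] ++ v)

/-- `Reach n c a b`: there is a finite sequence of elementary modifications in `B_n`
transforming `a` into `b` and containing exactly `c` modifications of type (1). -/
inductive Reach (n : ℕ) : ℕ → BraidWord → BraidWord → Prop
  | refl (a : BraidWord) : Reach n 0 a a
  | step1 {a b c : BraidWord} {k : ℕ} : Move1 n a b → Reach n k b c → Reach n (k+1) a c
  | step2 {a b c : BraidWord} {k : ℕ} : Move2 n a b → Reach n k b c → Reach n k a c
  | step3 {a b c : BraidWord} {k : ℕ} : Move3 n a b → Reach n k b c → Reach n k a c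

/-- The distance `d(a,b)`: the minimal number of type (1) modifications among all
finite sequences of elementary modifications transforming `a` into `b`. -/
noncomputable def braidDist (n : ℕ) (a b : BraidWord) : ℕ := sInf {c | Reach n c a b}


/-- The `k`-fold concatenation `w^k` of a word. -/
def wpow (w : BraidWord) (k : ℕ) : BraidWord := (List.replicate k w).flatten

/-- The formal inverse `w⁻¹` of a word: letters inverted and order reversed. -/
def winv (w : BraidWord) : BraidWord := w.reverse.map (fun l => (l.1, !l.2))

/-- The word `V = σ_1²`. -/
def V : BraidWord := [(1, true), (1, true)]

/-- The word `W = σ_2 σ_1² σ_2`. -/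
def W : BraidWord := [(2, true), (1, true), (1, true), (2, true)]

/-- The word `a_k = W^{-k} V^k W^k V^{-k}`. -/
def ak (k : ℕ) : BraidWord := winv (wpow W k) ++ wpow V k ++ wpow W k ++ winv (wpow V k)

/-- The word `b_k = W^{-k} W^k V^k V^{-k}`. -/
def bk (k : ℕ) : BraidWord := winv (wpow W k) ++ wpow W k ++ wpow V k ++ winv (wpow V k)


/-- The group homomorphism out of `B_3` determined by two elements satisfying the braid relation. -/
def liftThree {H : Type*} [Group H] (x y : H) (h : x * y * x = y * x * y) : BraidGroup 3 →* H :=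
  PresentedGroup.toGroup (f := fun i : ℕ => if i = 1 then x else if i = 2 then y else 1) <| by
    rintro r (⟨i, h1, h2, rfl⟩ | ⟨i, j, h1, h2, h3, h4, h5, rfl⟩)
    · obtain rfl : i = 1 := by omega
      rw [map_mul, map_inv, mul_inv_eq_one]
      simpa using h
    · omega

/-- The generator `σ_1` of `B_3`. -/
def s₁ : BraidGroup 3 := PresentedGroup.of 1

/-- The generator `σ_2` of `B_3`. -/
def s₂ : BraidGroup 3 := PresentedGroup.of 2

/-- The element of `B_3` represented by `W`. -/
def wElt : BraidGroup 3 := s₂ * s₁ * s₁ * s₂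

@[simp]
lemma liftThree_s₁ {H : Type*} [Group H] (x y : H) (h : x * y * x = y * x * y) :
    liftThree x y h s₁ = x := by
  simp [liftThree, s₁]

@[simp]
lemma liftThree_s₂ {H : Type*} [Group H] (x y : H) (h : x * y * x = y * x * y) :
    liftThree x y h s₂ = y := by
  simp [liftThree, s₂]

lemma braid_relation : s₁ * s₂ * s₁ = s₂ * s₁ * s₂ := by
  refine PresentedGroup.mk_eq_mk_of_mul_inv_mem
    (x := .of 1 * .of 2 * .of 1) (y := .of 2 * .of 1 * .of 2) ?_
  exact Or.inl ⟨1, le_rfl, le_rfl, rfl⟩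

lemma commute_s₁_wElt : Commute s₁ wElt := by
  have h := braid_relation
  calc s₁ * (s₂ * s₁ * s₁ * s₂) = s₁ * s₂ * s₁ * s₁ * s₂ := by group
    _ = s₂ * s₁ * (s₂ * s₁ * s₂) := by rw [h]; group
    _ = s₂ * s₁ * s₁ * s₂ * s₁ := by rw [← h]; group

lemma eval_append (n : ℕ) (u v : BraidWord) : eval n (u ++ v) = eval n u * eval n v := by
  simp [eval]

lemma wpow_succ (w : BraidWord) (k : ℕ) : wpow w (k + 1) = w ++ wpow w k := by
  simp [wpow, List.replicate_succ]

lemma eval_wpow (n : ℕ) (w : BraidWord) (k : ℕ) : eval n (wpow w k) = eval n w ^ k := by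
  induction k with
  | zero => simp [wpow, eval]
  | succ k ih => rw [wpow_succ, eval_append, ih, pow_succ']

lemma eval_V : eval 3 V = s₁ ^ 2 := by
  simp [eval, V, evalLetter, s₁, pow_two]

lemma eval_W : eval 3 W = wElt := by
  simp [eval, W, evalLetter, wElt, s₁, s₂, mul_assoc]

/-! ### Upper bound: an explicit sequence of modifications -/

lemma Reach.trans {n c d : ℕ} {x y z : BraidWord} (h₁ : Reach n c x y) (h₂ : Reach n d y z) :
    Reach n (c + d) x z := by
  induction h₁ with
  | refl => simpa using h₂
  | step1 h _ ih => rw [add_right_comm]; exact .step1 h (ih h₂)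
  | step2 h _ ih => exact .step2 h (ih h₂)
  | step3 h _ ih => exact .step3 h (ih h₂)

lemma Move1.append {n : ℕ} {x y : BraidWord} (h : Move1 n x y) (p q : BraidWord) :
    Move1 n (p ++ x ++ q) (p ++ y ++ q) := by
  cases h with
  | fwd u v i h1 h2 => simpa using Move1.fwd (p ++ u) (v ++ q) i h1 h2
  | bwd u v i h1 h2 => simpa using Move1.bwd (p ++ u) (v ++ q) i h1 h2

lemma Move2.append {n : ℕ} {x y : BraidWord} (h : Move2 n x y) (p q : BraidWord) :
    Move2 n (p ++ x ++ q) (p ++ y ++ q) := by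
  cases h with
  | swap u v i j h1 h2 h3 h4 h5 => simpa using Move2.swap (p ++ u) (v ++ q) i j h1 h2 h3 h4 h5

lemma Move3.append {n : ℕ} {x y : BraidWord} (h : Move3 n x y) (p q : BraidWord) :
    Move3 n (p ++ x ++ q) (p ++ y ++ q) := by
  cases h with
  | del u v i b h1 h2 => simpa using Move3.del (p ++ u) (v ++ q) i b h1 h2
  | ins u v i b h1 h2 => simpa using Move3.ins (p ++ u) (v ++ q) i b h1 h2

lemma Reach.append {n c : ℕ} {x y : BraidWord} (h : Reach n c x y) (p q : BraidWord) :
    Reach n c (p ++ x ++ q) (p ++ y ++ q) := by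
  induction h with
  | refl => exact .refl _
  | step1 h _ ih => exact .step1 (h.append p q) ih
  | step2 h _ ih => exact .step2 (h.append p q) ih
  | step3 h _ ih => exact .step3 (h.append p q) ih

lemma reach_s₁_W : Reach 3 2 ((1, true) :: W) (W ++ [(1, true)]) :=
  .step1 (.fwd [] [(1, true), (2, true)] 1 le_rfl le_rfl) <|
    .step1 (.bwd [(2, true), (1, true)] [] 1 le_rfl le_rfl) (.refl _)

lemma reach_V_W : Reach 3 4 (V ++ W) (W ++ V) := by
  simpa [V] using (reach_s₁_W.append [(1, true)] []).trans (reach_s₁_W.append [] [(1, true)])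

/-- If `x` can be moved past `y` at cost `c`, it can be moved past `y ^ k` at cost `c * k`. -/
lemma Reach.append_wpow {n c : ℕ} {x y : BraidWord} (h : Reach n c (x ++ y) (y ++ x)) (k : ℕ) :
    Reach n (c * k) (x ++ wpow y k) (wpow y k ++ x) := by
  induction k with
  | zero => simpa [wpow] using Reach.refl (n := n) x
  | succ k ih =>
    rw [wpow_succ, mul_add_one, add_comm]
    have := (h.append [] (wpow y k)).trans (d := c * k) (z := y ++ wpow y k ++ x)
      (by simpa using ih.append y [])
    simpa using this

/-- If `x` can be moved past `y` at cost `c`, then `x ^ k` can be moved past `y` at cost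
`c * k`. -/
lemma Reach.wpow_append {n c : ℕ} {x y : BraidWord} (h : Reach n c (x ++ y) (y ++ x)) (k : ℕ) :
    Reach n (c * k) (wpow x k ++ y) (y ++ wpow x k) := by
  induction k with
  | zero => simpa [wpow] using Reach.refl (n := n) y
  | succ k ih =>
    rw [wpow_succ, mul_add_one]
    have := (ih.append x []).trans (d := c) (z := y ++ x ++ wpow x k)
      (by simpa using h.append [] (wpow x k))
    simpa using this

lemma reach_wpow_V_W (k : ℕ) :
    Reach 3 (4 * k ^ 2) (wpow V k ++ wpow W k) (wpow W k ++ wpow V k) := by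
  simpa [pow_two, mul_assoc] using (reach_V_W.append_wpow k).wpow_append k

/-! ### The Fox derivative -/

/-- The inclusion of `B_3` in its integral group ring. -/
noncomputable abbrev ι : BraidGroup 3 →* MonoidAlgebra ℤ (BraidGroup 3) := MonoidAlgebra.of ℤ _

/-- The Fox derivative of a letter with respect to `σ_1`. -/
noncomputable def foxLetter (l : BraidLetter) : MonoidAlgebra ℤ (BraidGroup 3) :=
  if l.1 = 1 then (if l.2 then 1 else -ι s₁⁻¹) else 0

/-- The Fox derivative of a word with respect to `σ_1`, in the integral group ring of `B_3`. -/
noncomputable def fox : BraidWord → MonoidAlgebra ℤ (BraidGroup 3)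
  | [] => 0
  | l :: w => foxLetter l + ι (evalLetter 3 l) * fox w

lemma fox_append (u v : BraidWord) : fox (u ++ v) = fox u + ι (eval 3 u) * fox v := by
  induction u with
  | nil => simp [fox, eval, ← MonoidAlgebra.one_def]
  | cons l u ih =>
    have : eval 3 (l :: u) = evalLetter 3 l * eval 3 u := by simp [eval]
    rw [List.cons_append, fox, ih, fox, this, map_mul]
    noncomm_ring

/-- The Fox derivative with respect to `σ_1` of the braid relation. -/
noncomputable def foxRel : MonoidAlgebra ℤ (BraidGroup 3) := 1 - ι s₂ + ι (s₁ * s₂)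

lemma fox_cancel (i : ℕ) (b : Bool) : fox [(i, b), (i, !b)] = 0 := by
  by_cases h : i = 1
  · subst h
    cases b <;> simp [fox, foxLetter, evalLetter, s₁, ← map_mul, -MonoidAlgebra.of_apply]
  · simp [fox, foxLetter, h]

lemma eval_cancel (n i : ℕ) (b : Bool) : eval n [(i, b), (i, !b)] = 1 := by
  cases b <;> simp [eval, evalLetter]

lemma Move3.fox_eq {n : ℕ} {x y : BraidWord} (h : Move3 n x y) : fox x = fox y := by
  cases h <;> simp only [fox_append, eval_append, fox_cancel, eval_cancel] <;> simp

lemma fox_braid :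
    fox [(1, true), (2, true), (1, true)] - fox [(2, true), (1, true), (2, true)] = foxRel := by
  simp only [fox, foxLetter, evalLetter, foxRel, s₁, s₂, map_mul]
  simp only [↓reduceIte, OfNat.ofNat_ne_one, mul_zero, add_zero, zero_add, mul_one]
  abel

lemma eval_braid :
    eval 3 [(1, true), (2, true), (1, true)] = eval 3 [(2, true), (1, true), (2, true)] := by
  simpa [eval, evalLetter, s₁, s₂, mul_assoc] using braid_relation

lemma Move1.fox_sub {x y : BraidWord} (h : Move1 3 x y) :
    ∃ g : BraidGroup 3, fox x - fox y = ι g * foxRel ∨ fox x - fox y = -ι g * foxRel := by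
  cases h with
  | fwd u v i h1 h2 =>
    obtain rfl : i = 1 := by omega
    refine ⟨eval 3 u, .inl ?_⟩
    simp only [fox_append, eval_append, Nat.reduceAdd, eval_braid, ← fox_braid]
    noncomm_ring
  | bwd u v i h1 h2 =>
    obtain rfl : i = 1 := by omega
    refine ⟨eval 3 u, .inr ?_⟩
    simp only [fox_append, eval_append, Nat.reduceAdd, eval_braid, ← fox_braid]
    noncomm_ring

/-- Additive extension of an integer-valued function on `B_3` to the group ring. -/
noncomputable def extend (φ : BraidGroup 3 → ℤ) : MonoidAlgebra ℤ (BraidGroup 3) →+ ℤ :=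
  (Finsupp.liftAddHom fun g => AddMonoidHom.mulLeft (φ g)).comp
    MonoidAlgebra.coeffAddEquiv.toAddMonoidHom

lemma extend_ι (φ : BraidGroup 3 → ℤ) (g : BraidGroup 3) : extend φ (ι g) = φ g := by
  simp [extend]

/-- The difference of Fox derivatives of two words at cost `c` is the boundary of a chain on which
every functional bounded by one is bounded by `c`. -/
lemma Reach.exists_chain {φ : BraidGroup 3 → ℤ} (hφ : ∀ g, |φ g| ≤ 1) {c : ℕ} {x y : BraidWord}
    (h : Reach 3 c x y) :
    ∃ C, fox x - fox y = C * foxRel ∧ |extend φ C| ≤ c := by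
  induction h with
  | refl => exact ⟨0, by simp⟩
  | @step1 x y z k h _ ih =>
    obtain ⟨C, hC, hc⟩ := ih
    obtain ⟨g, hg | hg⟩ := h.fox_sub
    · refine ⟨ι g + C, by rw [add_mul, ← hC, ← hg]; abel, ?_⟩
      rw [map_add, extend_ι, Nat.cast_succ, add_comm]
      exact (abs_add_le _ _).trans (add_le_add hc (hφ g))
    · refine ⟨-ι g + C, by rw [add_mul, ← hC, ← hg]; abel, ?_⟩
      rw [map_add, map_neg, extend_ι, Nat.cast_succ, add_comm]
      exact (abs_add_le _ _).trans (add_le_add hc ((abs_neg _).trans_le (hφ g)))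
  | step2 h _ _ => cases h; omega
  | step3 h _ ih => rwa [h.fox_eq]

/-- The exponent sum of a braid. -/
def expSum : BraidGroup 3 →* Multiplicative ℤ :=
  liftThree (.ofAdd 1) (.ofAdd 1) rfl

/-- Right multiplication by the Fox derivative of the braid relation is injective: a coefficient of
minimal exponent sum survives. -/
lemma mul_foxRel_injective : Function.Injective (· * foxRel) := by
  refine (injective_iff_map_eq_zero (AddMonoidHom.mulRight foxRel)).2 fun x hx => ?_
  rw [AddMonoidHom.mulRight_apply] at hx
  by_contra hne
  obtain ⟨g, hg, hmin⟩ := x.coeff.support.exists_min_image (fun g => (expSum g).toAdd)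
    (by simpa using hne)
  have hlow : ∀ h, (expSum h).toAdd < (expSum g).toAdd → x.coeff h = 0 := fun h hh => by
    by_contra hx
    exact absurd (hmin h (by simpa using hx)) (not_le.2 hh)
  have key : (x * foxRel).coeff g = x.coeff g - x.coeff (g * s₂⁻¹) + x.coeff (g * (s₁ * s₂)⁻¹) := by
    simp [foxRel, mul_add, mul_sub, MonoidAlgebra.coeff_mul_single_apply, -mul_inv_rev]
  rw [hx, hlow (g * s₂⁻¹) (by simp [expSum]), hlow (g * (s₁ * s₂)⁻¹) (by simp [expSum])] at key
  simp at key hg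
  exact hg key.symm

/-! ### The chain between the two words -/

lemma fox_wpow (w : BraidWord) (k : ℕ) :
    fox (wpow w k) = (∑ i ∈ Finset.range k, ι (eval 3 w) ^ i) * fox w := by
  induction k with
  | zero => simp [wpow, fox]
  | succ k ih =>
    rw [wpow_succ, fox_append, ih, Finset.sum_range_succ', pow_zero, add_mul, one_mul,
      ← mul_assoc, Finset.mul_sum, add_comm]
    simp only [pow_succ']

lemma fox_V : fox V = 1 + ι s₁ := by
  simp [fox, V, foxLetter, evalLetter, s₁]

lemma fox_W : fox W = ι s₂ + ι s₂ * ι s₁ := by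
  simp [fox, W, foxLetter, evalLetter, s₁, s₂, mul_add]

/-- The chain swept out when moving `σ_1 ^ (2 * k)` past `W ^ k`. -/
noncomputable def gridChain (k : ℕ) : MonoidAlgebra ℤ (BraidGroup 3) :=
  (∑ j ∈ Finset.range k, ι wElt ^ j) * (∑ i ∈ Finset.range (2 * k), ι s₁ ^ i) *
    (1 - ι (s₂ * s₁))

lemma sum_pow_two_mul {R : Type*} [Semiring R] (x : R) (k : ℕ) :
    (∑ i ∈ Finset.range k, (x ^ 2) ^ i) * (1 + x) = ∑ i ∈ Finset.range (2 * k), x ^ i := by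
  induction k with
  | zero => simp
  | succ k ih =>
    rw [Finset.sum_range_succ, add_mul, ih, mul_add_one, Finset.sum_range_succ,
      Finset.sum_range_succ, mul_add, ← pow_mul, mul_one, ← pow_succ, add_assoc]

lemma gridChain_mul_foxRel (k : ℕ) :
    fox (wpow V k ++ wpow W k) - fox (wpow W k ++ wpow V k) = gridChain k * foxRel := by
  have hc : Commute (ι s₁) (ι wElt) := commute_s₁_wElt.map ι
  set S := ∑ i ∈ Finset.range (2 * k), ι s₁ ^ i
  set T := ∑ j ∈ Finset.range k, ι wElt ^ j
  have hST : S * T = T * S :=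
    Commute.sum_left _ _ _ fun i _ => Commute.sum_right _ _ _ fun j _ => hc.pow_pow i j
  have h₁ : 1 - ι s₁ ^ (2 * k) = S * (1 - ι s₁) := (geom_sum_mul_neg _ _).symm
  have h₂ : 1 - ι wElt ^ k = T * (1 - ι wElt) := (geom_sum_mul_neg _ _).symm
  have hST' : (1 - ι wElt) * S = S * (1 - ι wElt) :=
    (Commute.sum_right _ _ _ fun i _ =>
      ((Commute.one_left _).sub_left hc.symm).pow_right i : Commute _ S)
  have hTS' : (1 - ι s₁) * T = T * (1 - ι s₁) :=
    (Commute.sum_right _ _ _ fun i _ =>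
      ((Commute.one_left _).sub_left hc).pow_right i : Commute _ T)
  have hV : fox (wpow V k) = S := by
    rw [fox_wpow, fox_V, eval_V, map_pow, sum_pow_two_mul]
  have hW : fox (wpow W k) = T * (ι s₂ + ι s₂ * ι s₁) := by
    rw [fox_wpow, fox_W, eval_W]
  have hrel : 1 - ι wElt - (1 - ι s₁) * (ι s₂ + ι s₂ * ι s₁) = (1 - ι (s₂ * s₁)) * foxRel := by
    have := congrArg ι braid_relation
    simp only [map_mul] at this
    simp only [foxRel, wElt, map_mul]
    rw [← sub_eq_zero] at this ⊢
    rw [← this]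
    noncomm_ring
  calc fox (wpow V k ++ wpow W k) - fox (wpow W k ++ wpow V k)
      = (1 - ι wElt ^ k) * S - (1 - ι s₁ ^ (2 * k)) * (T * (ι s₂ + ι s₂ * ι s₁)) := by
        rw [fox_append, fox_append, hV, hW, eval_wpow, eval_wpow, eval_V, eval_W, map_pow, map_pow,
          map_pow, ← pow_mul]
        noncomm_ring
    _ = T * S * (1 - ι wElt - (1 - ι s₁) * (ι s₂ + ι s₂ * ι s₁)) := by
        rw [h₁, h₂, mul_assoc, hST', mul_assoc S, ← mul_assoc (1 - ι s₁), hTS', ← mul_assoc S,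
          ← mul_assoc S, hST]
        noncomm_ring
    _ = gridChain k * foxRel := by rw [hrel, gridChain, ← mul_assoc]

/-! ### Separating the two kinds of cells -/

/-- The standard homomorphism `B_3 → SL(2, ℤ)`. -/
def toSL : BraidGroup 3 →* Matrix.SpecialLinearGroup (Fin 2) ℤ :=
  liftThree ⟨!![1, 1; 0, 1], by simp⟩ ⟨!![1, 0; -1, 1], by simp⟩ (by decide)

lemma toSL_s₁ : (toSL s₁).1 = !![1, 1; 0, 1] :=
  congrArg Subtype.val (liftThree_s₁ (H := Matrix.SpecialLinearGroup (Fin 2) ℤ) _ _ _)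

lemma toSL_s₂ : (toSL s₂).1 = !![1, 0; -1, 1] :=
  congrArg Subtype.val (liftThree_s₂ (H := Matrix.SpecialLinearGroup (Fin 2) ℤ) _ _ _)

/-- The braids whose image in `SL(2, ℤ)` is upper triangular. -/
def upper : Submonoid (BraidGroup 3) where
  carrier := {g | (toSL g).1 1 0 = 0}
  one_mem' := by simp
  mul_mem' {g h} hg hh := by
    simp only [Set.mem_ofPred_eq] at hg hh
    simp [Matrix.mul_apply, hg, hh]

lemma s₁_mem_upper : s₁ ∈ upper := by
  change (toSL s₁).1 1 0 = 0
  simp [toSL_s₁]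

lemma wElt_mem_upper : wElt ∈ upper := by
  change (toSL wElt).1 1 0 = 0
  simp [wElt, Matrix.mul_apply, toSL_s₁, toSL_s₂]

lemma mul_s₂_s₁_notMem_upper {g : BraidGroup 3} (hg : g ∈ upper) : g * (s₂ * s₁) ∉ upper := by
  change (toSL g).1 1 0 = 0 at hg
  change ¬(toSL (g * (s₂ * s₁))).1 1 0 = 0
  have hdet := (toSL g).2
  rw [Matrix.det_fin_two, hg] at hdet
  have : (toSL (g * (s₂ * s₁))).1 1 0 = -(toSL g).1 1 1 := by
    simp [Matrix.mul_apply, toSL_s₁, toSL_s₂, hg]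
  rw [this]
  intro h
  rw [neg_eq_zero.1 h] at hdet
  simp at hdet

open Classical in
/-- The sign function that is `1` on `upper` and `-1` elsewhere. -/
noncomputable def cellSign (g : BraidGroup 3) : ℤ := if g ∈ upper then 1 else -1

lemma abs_cellSign_le (g : BraidGroup 3) : |cellSign g| ≤ 1 := by
  unfold cellSign; split <;> simp

lemma extend_gridChain (k : ℕ) : extend cellSign (gridChain k) = 4 * k ^ 2 := by
  have h : ∀ j i, cellSign (wElt ^ j * s₁ ^ i) - cellSign (wElt ^ j * s₁ ^ i * (s₂ * s₁)) = 2 := by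
    intro j i
    have hmem := mul_mem (pow_mem wElt_mem_upper j) (pow_mem s₁_mem_upper i)
    rw [cellSign, cellSign, if_pos hmem, if_neg (mul_s₂_s₁_notMem_upper hmem)]
    norm_num
  simp only [gridChain, Finset.sum_mul_sum]
  simp only [Finset.sum_mul, ← map_pow, ← map_mul, mul_sub, mul_one, ← Finset.sum_sub_distrib,
    map_sum, map_sub, extend_ι, h]
  simp
  ring

lemma Reach.four_mul_sq_le {k c : ℕ} (h : Reach 3 c (wpow V k ++ wpow W k)
    (wpow W k ++ wpow V k)) : 4 * k ^ 2 ≤ c := by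
  obtain ⟨C, hC, hc⟩ := h.exists_chain abs_cellSign_le
  rw [gridChain_mul_foxRel] at hC
  rw [← mul_foxRel_injective hC, extend_gridChain] at hc
  exact_mod_cast (le_abs_self _).trans hc

/-- For every `k ≥ 1`, `d(V^k W^k, W^k V^k) = 4k²`; these two words represent the
same, non-identity, element of `B_3`. -/
theorem statement_11 (k : ℕ) (hk : 1 ≤ k) :
    eval 3 (wpow V k ++ wpow W k) = eval 3 (wpow W k ++ wpow V k) ∧
    eval 3 (wpow V k ++ wpow W k) ≠ 1 ∧
    braidDist 3 (wpow V k ++ wpow W k) (wpow W k ++ wpow V k) = 4 * k ^ 2 := by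
  refine ⟨?_, fun h => ?_, ?_⟩
  · simp only [eval_append, eval_wpow, eval_V, eval_W]
    exact (commute_s₁_wElt.pow_left 2).pow_pow k k
  · simp only [eval_append, eval_wpow, eval_V, eval_W] at h
    have := congrArg (fun g => (expSum g).toAdd) h
    simp [expSum, wElt] at this
    omega
  · exact le_antisymm (Nat.sInf_le (reach_wpow_V_W k))
      (le_csInf ⟨_, reach_wpow_V_W k⟩ fun c hc => hc.four_mul_sq_le)

end Braid
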